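/- arXiv:1706.06330 — 4 statements merged into one kernel-verified Lean document; each statement's English description precedes it below -/
import Mathlib

section
/- Let (V,π) be a filtered directed system over ℝ₊ such that A = colim V carries a K-algebra multiplication ⋆, and assume the spectral number c is subadditive with respect to ⋆. Then for every finite subset S ⊆ A with ρ(S) = max_{x∈S} c(x) > 0, the exponential growth rate satisfies Γ̃(V) ≥ Γ^alg_S(A) / ρ(S). -/
open scoped NNReal

/-- A filtered directed system of finite-dimensional `K`-vector spaces over `ℝ₊ = [0,∞)`. -/
structure FDS (K : Type) [Field K] where
  V : ℝ≥0 → Type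
  [acg : ∀ t, AddCommGroup (V t)]
  [mod : ∀ t, Module K (V t)]
  [fd : ∀ t, FiniteDimensional K (V t)]
  map : ∀ {s t : ℝ≥0}, s ≤ t → V s →ₗ[K] V t
  map_self : ∀ (t : ℝ≥0) (x : V t), map (le_refl t) x = x
  map_map : ∀ {r s t : ℝ≥0} (h1 : r ≤ s) (h2 : s ≤ t) (x : V r),
      map h2 (map h1 x) = map (h1.trans h2) x

attribute [instance] FDS.acg FDS.mod FDS.fd

/-- The direct limit (colimit) of a filtered directed system, presented as a cocone
`ι t : V t → A` which is jointly surjective and exact (the standard description of the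
direct limit over the directed set `[0,∞)`). -/
structure FDSColimit (K : Type) [Field K] (V : FDS K) where
  A : Type
  [acg : AddCommGroup A]
  [mod : Module K A]
  ι : ∀ t : ℝ≥0, V.V t →ₗ[K] A
  ι_map : ∀ {s t : ℝ≥0} (h : s ≤ t) (x : V.V s), ι t (V.map h x) = ι s x
  surj : ∀ a : A, ∃ t x, ι t x = a
  exct : ∀ (t : ℝ≥0) (x : V.V t), ι t x = 0 → ∃ s, ∃ h : t ≤ s, V.map h x = 0

attribute [instance] FDSColimit.acg FDSColimit.mod

/-- The spectral number `c(x) = inf {t | x ∈ range (ι t)}`. -/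
noncomputable def FDSColimit.spec {K : Type} [Field K] {V : FDS K}
    (C : FDSColimit K V) (x : C.A) : ℝ≥0 :=
  sInf {t : ℝ≥0 | x ∈ LinearMap.range (C.ι t)}


/-- The exponential growth rate `Γ̃(V) = limsup_{t→∞} log(d_t)/t` of a filtered directed
system, where `d_t = dim_K {x ∈ colim V | c(x) ≤ t}` (with the convention `log 0 = 0`,
which is `Real.log`'s convention), taken in the extended reals. -/
noncomputable def FDSColimit.growth {K : Type} [Field K] {V : FDS K}
    (C : FDSColimit K V) : EReal :=
  Filter.limsup (fun t : ℝ≥0 =>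
    ((Real.log (Module.finrank K (Submodule.span K {x : C.A | C.spec x ≤ t})) / (t : ℝ) : ℝ) :
      EReal)) Filter.atTop

/-- For a (not necessarily unital) `K`-algebra structure given by a `K`-bilinear
multiplication `mul` on `A` and a subset `S ⊆ A`, `WSpan mul S n` is the `K`-linear span of
the set `⋃_{j=1}^n N_S(j)` of all products of at most `n` (and at least one) elements of `S`. -/
def WSpan {K : Type} [Field K] {A : Type} [AddCommGroup A] [Module K A]
    (mul : A →ₗ[K] A →ₗ[K] A) (S : Set A) (n : ℕ) : Submodule K A :=
  Submodule.span K {a : A | ∃ (h : A) (l : List A), h ∈ S ∧ (∀ x ∈ l, x ∈ S) ∧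
    l.length + 1 ≤ n ∧ a = l.foldl (fun x y => mul x y) h}

/-- The exponential algebraic growth rate
`Γ^alg_S(A) = limsup_{n→∞} (1/n) log dim_K W_S(n)` (with the convention `log 0 = 0`,
which is `Real.log`'s convention). -/
noncomputable def algGrowth {K : Type} [Field K] {A : Type} [AddCommGroup A] [Module K A]
    (mul : A →ₗ[K] A →ₗ[K] A) (S : Set A) : ℝ :=
  Filter.limsup
    (fun n : ℕ => Real.log (Module.finrank K (WSpan mul S n)) / (n : ℝ)) Filter.atTop

namespace FDSColimit

variable {K : Type} [Field K] {V : FDS K} (C : FDSColimit K V)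

theorem range_ι_mono {s t : ℝ≥0} (h : s ≤ t) :
    LinearMap.range (C.ι s) ≤ LinearMap.range (C.ι t) := by
  rintro _ ⟨x, rfl⟩
  exact ⟨V.map h x, C.ι_map h x⟩

theorem mem_range_ι_of_spec_lt {x : C.A} {t : ℝ≥0} (h : C.spec x < t) :
    x ∈ LinearMap.range (C.ι t) := by
  obtain ⟨r, y, hy⟩ := C.surj x
  obtain ⟨s, hs, hst⟩ :=
    exists_lt_of_csInf_lt (s := {t : ℝ≥0 | x ∈ LinearMap.range (C.ι t)}) ⟨r, y, hy⟩ h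
  exact C.range_ι_mono hst.le hs

theorem finiteDimensional_span_spec_le (t : ℝ≥0) :
    FiniteDimensional K (Submodule.span K {x : C.A | C.spec x ≤ t}) := by
  have h : Submodule.span K {x : C.A | C.spec x ≤ t} ≤ LinearMap.range (C.ι (t + 1)) :=
    Submodule.span_le.2 fun x hx =>
      C.mem_range_ι_of_spec_lt (lt_of_le_of_lt hx (lt_add_of_pos_right t one_pos))
  exact Submodule.finiteDimensional_of_le h

theorem spec_foldl_le {mul : C.A →ₗ[K] C.A →ₗ[K] C.A}
    (subadd : ∀ a b : C.A, C.spec (mul a b) ≤ C.spec a + C.spec b) {ρ : ℝ≥0}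
    (l : List C.A) (h : C.A) (hl : ∀ x ∈ l, C.spec x ≤ ρ) :
    C.spec (l.foldl (fun x y => mul x y) h) ≤ C.spec h + l.length * ρ := by
  induction l generalizing h with
  | nil => simp
  | cons a l ih =>
    have ha : C.spec a ≤ ρ := hl a (by simp)
    calc C.spec (l.foldl (fun x y => mul x y) (mul h a))
        ≤ C.spec (mul h a) + l.length * ρ := ih _ fun x hx => hl x (by simp [hx])
      _ ≤ C.spec h + ρ + l.length * ρ := by
        gcongr
        exact (subadd h a).trans (by gcongr)
      _ = C.spec h + (a :: l).length * ρ := by push_cast [List.length_cons]; ring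

theorem WSpan_le_span_spec_le {mul : C.A →ₗ[K] C.A →ₗ[K] C.A}
    (subadd : ∀ a b : C.A, C.spec (mul a b) ≤ C.spec a + C.spec b) {S : Set C.A} {ρ : ℝ≥0}
    (hS : ∀ x ∈ S, C.spec x ≤ ρ) (n : ℕ) :
    WSpan mul S n ≤ Submodule.span K {x : C.A | C.spec x ≤ n * ρ} := by
  refine Submodule.span_mono ?_
  rintro _ ⟨h, l, hh, hl, hn, rfl⟩
  calc C.spec (l.foldl (fun x y => mul x y) h)
      ≤ C.spec h + l.length * ρ := C.spec_foldl_le subadd l h fun x hx => hS x (hl x hx)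
    _ ≤ ρ + l.length * ρ := by gcongr; exact hS h hh
    _ = ((l.length + 1 : ℕ) : ℝ≥0) * ρ := by push_cast; ring
    _ ≤ n * ρ := by gcongr

theorem log_finrank_WSpan_le {mul : C.A →ₗ[K] C.A →ₗ[K] C.A}
    (subadd : ∀ a b : C.A, C.spec (mul a b) ≤ C.spec a + C.spec b) {S : Set C.A} {ρ : ℝ≥0}
    (hS : ∀ x ∈ S, C.spec x ≤ ρ) (n : ℕ) :
    Real.log (Module.finrank K (WSpan mul S n)) ≤
      Real.log (Module.finrank K (Submodule.span K {x : C.A | C.spec x ≤ n * ρ})) := by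
  have := C.finiteDimensional_span_spec_le (n * ρ)
  have h := Submodule.finrank_mono (C.WSpan_le_span_spec_le subadd hS n)
  rcases Nat.eq_zero_or_pos (Module.finrank K (WSpan mul S n)) with h0 | h0
  · rw [h0]
    simpa using Real.log_natCast_nonneg _
  · exact Real.log_le_log (by exact_mod_cast h0) (by exact_mod_cast h)

end FDSColimit

/-- If the spectral number of a filtered directed system `V` is subadditive with respect to
a `K`-algebra multiplication `⋆` on `A = colim V`, then for every finite subset `S ⊆ A` with
`ρ(S) = max_{x ∈ S} c(x) > 0` one has `Γ̃(V) ≥ Γ^alg_S(A) / ρ(S)`. -/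
theorem growth_ge_algGrowth_div_rho {K : Type} [Field K] {V : FDS K}
    (C : FDSColimit K V) (mul : C.A →ₗ[K] C.A →ₗ[K] C.A)
    (mul_assoc : ∀ a b c : C.A, mul (mul a b) c = mul a (mul b c))
    (subadd : ∀ a b : C.A, C.spec (mul a b) ≤ C.spec a + C.spec b)
    (S : Finset C.A) (hS : S.Nonempty)
    (hρ : 0 < S.sup' hS fun x => C.spec x) :
    ((algGrowth mul (↑S) / ((S.sup' hS fun x => C.spec x : ℝ≥0) : ℝ) : ℝ) : EReal) ≤
      C.growth := by
  set ρ := S.sup' hS fun x => C.spec x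
  have hSρ : ∀ x ∈ (S : Set C.A), C.spec x ≤ ρ := fun x hx =>
    Finset.le_sup' (fun x => C.spec x) (Finset.mem_coe.1 hx)
  have hρ' : (0 : ℝ) < ρ := hρ
  refine EReal.le_of_forall_lt_iff_le.1 fun b hb => ?_
  rw [EReal.coe_le_coe_iff, div_le_iff₀ hρ']
  have htend : Filter.Tendsto (fun n : ℕ => (n : ℝ≥0) * ρ) Filter.atTop Filter.atTop :=
    tendsto_natCast_atTop_atTop.atTop_mul_const hρ
  have hev := htend.eventually (Filter.eventually_lt_of_limsup_lt hb)
  refine Filter.limsup_le_of_le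
    (Filter.isCoboundedUnder_le_of_le Filter.atTop (x := 0) fun n =>
      div_nonneg (Real.log_natCast_nonneg _) n.cast_nonneg) ?_
  filter_upwards [hev, Filter.eventually_gt_atTop 0] with n hn hn0
  have hn' : (0 : ℝ) < n := by exact_mod_cast hn0
  rw [EReal.coe_lt_coe_iff, NNReal.coe_mul, NNReal.coe_natCast, div_lt_iff₀ (by positivity)] at hn
  rw [div_le_iff₀ hn']
  linarith [C.log_finrank_WSpan_le subadd hSρ n]
end

section
/- Let V be a filtered directed system over ℝ₊ such that A = colim V carries a K-algebra multiplication ⋆ with the spectral number c_V subadditive with respect to ⋆. Let 𝒲 = (W(i))_{i∈I} be a family of filtered directed systems over ℝ₊ such that for each i ∈ I the direct limit M(i) = colim W(i) is a module over (A,⋆) with scalar multiplication ∗(i), the spectral number c_{W(i)} is subadditive with respect to ∗(i), and the family (M(i))_{i∈I} is uniformly stretched over A. Then the uniform exponential growth rate satisfies Γ̃_{i∈I}(𝒲) ≥ Γ̃(V). -/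
open scoped NNReal

/-- A sublevel set of the spectral number spans a finite-dimensional subspace. -/
theorem FDSColimit.finiteDimensional_span_spec_le_s7 {K : Type} [Field K] {V : FDS K}
    (C : FDSColimit K V) (t : ℝ≥0) :
    FiniteDimensional K (Submodule.span K {x : C.A | C.spec x ≤ t}) := by
  have hle : Submodule.span K {x : C.A | C.spec x ≤ t} ≤ LinearMap.range (C.ι (t + 1)) := by
    rw [Submodule.span_le]
    intro x hx
    have hne : {s : ℝ≥0 | x ∈ LinearMap.range (C.ι s)}.Nonempty := by
      obtain ⟨s, y, hy⟩ := C.surj x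
      exact ⟨s, y, hy⟩
    have hlt : sInf {s : ℝ≥0 | x ∈ LinearMap.range (C.ι s)} < t + 1 :=
      lt_of_le_of_lt hx (lt_add_one t)
    obtain ⟨s, ⟨y, rfl⟩, hs⟩ := exists_lt_of_csInf_lt hne hlt
    exact ⟨V.map hs.le y, C.ι_map hs.le y⟩
  exact Submodule.finiteDimensional_of_le hle

/-- An injective linear map that raises spectral numbers by at most `B` embeds the sublevel
spaces at `t` into those at `t + B`. -/
theorem FDSColimit.finrank_span_spec_le_of_injective {K : Type} [Field K] {V W : FDS K}
    (C : FDSColimit K V) (D : FDSColimit K W) (f : C.A →ₗ[K] D.A)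
    (hf : Function.Injective f) {B : ℝ≥0} (hB : ∀ a, D.spec (f a) ≤ C.spec a + B) (t : ℝ≥0) :
    Module.finrank K (Submodule.span K {x : C.A | C.spec x ≤ t}) ≤
      Module.finrank K (Submodule.span K {x : D.A | D.spec x ≤ t + B}) := by
  have := D.finiteDimensional_span_spec_le_s7 (t + B)
  rw [(Submodule.equivMapOfInjective f hf _).finrank_eq]
  apply Submodule.finrank_mono
  rw [Submodule.map_span, Submodule.span_le]
  rintro _ ⟨x, hx, rfl⟩
  exact Submodule.subset_span ((hB x).trans (by gcongr; exact hx))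

/-- Bounding `u t` by a shift of `v` bounds the growth rate of `u` by that of `v`. -/
theorem limsup_div_le_limsup_div_of_le_shift {u v : ℝ≥0 → ℝ} {B : ℝ≥0}
    (h : ∀ t, u t ≤ v (t + B)) :
    Filter.limsup (fun t : ℝ≥0 => ((u t / (t : ℝ) : ℝ) : EReal)) Filter.atTop ≤
      Filter.limsup (fun t : ℝ≥0 => ((v t / (t : ℝ) : ℝ) : EReal)) Filter.atTop := by
  refine le_of_forall_gt_imp_ge_of_dense fun c' hc' => ?_
  obtain ⟨c₂, hc₂, hc₂'⟩ := EReal.lt_iff_exists_real_btwn.1 hc'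
  obtain ⟨c, hc, hcc₂⟩ := EReal.lt_iff_exists_real_btwn.1 hc₂
  have hcc : c < c₂ := EReal.coe_lt_coe_iff.1 hcc₂
  obtain ⟨T, hT⟩ := Filter.eventually_atTop.1 (Filter.eventually_lt_of_limsup_lt hc)
  refine le_trans (Filter.limsup_le_of_le (h := ?_)) hc₂'.le
  filter_upwards [Filter.eventually_ge_atTop T, Filter.eventually_gt_atTop 0,
    Filter.eventually_ge_atTop (Real.toNNReal (c * B / (c₂ - c)))] with t htT ht0 ht
  have ht0' : (0 : ℝ) < t := ht0
  have hv : v (t + B) / ((t + B : ℝ≥0) : ℝ) < c :=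
    EReal.coe_lt_coe_iff.1 (hT (t + B) (htT.trans le_self_add))
  rw [NNReal.coe_add, div_lt_iff₀ (by positivity)] at hv
  have ht' : c * B / (c₂ - c) ≤ t := Real.toNNReal_le_iff_le_coe.1 ht
  rw [div_le_iff₀ (sub_pos.2 hcc)] at ht'
  rw [EReal.coe_le_coe_iff, div_le_iff₀ ht0']
  linarith [h t]

/-- Let `A = colim V` carry a `K`-algebra multiplication `⋆` with subadditive spectral
number, and let `(W i)_{i ∈ I}` be a family of filtered directed systems whose direct limits
`M i = colim (W i)` are modules over `(A,⋆)` with subadditive spectral numbers, the family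
being uniformly stretched over `A`. Then the uniform exponential growth rate
`Γ̃_{i∈I}(𝒲) = limsup_{t→∞} (1/t) log (inf_i d_t^{W i})` is at least `Γ̃(V)`. -/
theorem uniform_growth_ge_growth {K : Type} [Field K] {V : FDS K}
    (CV : FDSColimit K V)
    (mul : CV.A →ₗ[K] CV.A →ₗ[K] CV.A)
    (mul_assoc : ∀ a b c : CV.A, mul (mul a b) c = mul a (mul b c))
    (subadd_mul : ∀ a b : CV.A, CV.spec (mul a b) ≤ CV.spec a + CV.spec b)
    {I : Type} [Nonempty I] (W : I → FDS K) (CW : ∀ i, FDSColimit K (W i))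
    (smul : ∀ i, CV.A →ₗ[K] (CW i).A →ₗ[K] (CW i).A)
    (smul_mul : ∀ (i : I) (a b : CV.A) (m : (CW i).A),
        smul i (mul a b) m = smul i a (smul i b m))
    (subadd_smul : ∀ (i : I) (a : CV.A) (m : (CW i).A),
        (CW i).spec (smul i a m) ≤ CV.spec a + (CW i).spec m)
    (unif_stretched : ∃ B : ℝ≥0, ∀ i : I, ∃ m : (CW i).A,
        (∀ a : CV.A, a ≠ 0 → smul i a m ≠ 0) ∧ (CW i).spec m ≤ B) :
    CV.growth ≤
      Filter.limsup (fun t : ℝ≥0 =>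
        ((Real.log (sInf (Set.range fun i : I =>
              Module.finrank K
                (Submodule.span K {x : (CW i).A | (CW i).spec x ≤ t}))) / (t : ℝ) : ℝ) :
          EReal)) Filter.atTop := by
  obtain ⟨B, hB⟩ := unif_stretched
  refine limsup_div_le_limsup_div_of_le_shift (B := B) fun t => ?_
  obtain ⟨i, hi⟩ := Nat.sInf_mem (Set.range_nonempty fun i : I =>
    Module.finrank K (Submodule.span K {x : (CW i).A | (CW i).spec x ≤ t + B}))
  obtain ⟨m, hm, hmB⟩ := hB i
  have hinj : Function.Injective ((smul i).flip m) :=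
    (injective_iff_map_eq_zero _).2 fun a ha => by_contra fun h0 => hm a h0 ha
  have hle := CV.finrank_span_spec_le_of_injective (CW i) ((smul i).flip m) hinj (B := B)
    (fun a => (subadd_smul i a m).trans (by gcongr)) t
  have hleast : IsLeast (Set.range fun j : I => (Module.finrank K
      (Submodule.span K {x : (CW j).A | (CW j).spec x ≤ t + B}) : ℝ))
      (Module.finrank K (Submodule.span K {x : (CW i).A | (CW i).spec x ≤ t + B})) := by
    refine ⟨⟨i, rfl⟩, ?_⟩
    rintro _ ⟨j, rfl⟩
    exact Nat.cast_le.2 (hi.trans_le (Nat.sInf_le ⟨j, rfl⟩))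
  rw [hleast.csInf_eq]
  rcases Nat.eq_zero_or_pos
      (Module.finrank K (Submodule.span K {x : CV.A | CV.spec x ≤ t})) with h0 | hpos
  · rw [h0, Nat.cast_zero, Real.log_zero]
    exact Real.log_natCast_nonneg _
  · exact Real.log_le_log (Nat.cast_pos.2 hpos) (Nat.cast_le.2 hle)
end

section
/- Let G be a group, K a field, and S ⊆ G a finite subset with image S̄ in the group algebra K[G]. Then Γ^alg_{S̄}(K[G]) = limsup_{n→∞} (1/n) log card B_S(n), where B_S(n) = {g ∈ G | g = s₁s₂⋯s_j for some 1 ≤ j ≤ n and s₁,…,s_j ∈ S}. In particular, when S is a symmetric finite generating set of G, the exponential algebraic growth rate of the pair (K[G], S̄) coincides with the exponential growth rate of the group G with respect to S. -/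
/-- `ballSet S n = {g ∈ G | g = s₁⋯s_j for some 1 ≤ j ≤ n, s₁,…,s_j ∈ S}`, the set of
elements of `G` expressible as a product of at least one and at most `n` elements of `S`. -/
def ballSet {G : Type} [Group G] (S : Set G) (n : ℕ) : Set G :=
  {g : G | ∃ (h : G) (l : List G), h ∈ S ∧ (∀ x ∈ l, x ∈ S) ∧
    l.length + 1 ≤ n ∧ g = l.foldl (· * ·) h}

theorem setOf_foldl_mul_image_eq_image_ballSet {K : Type} [Field K] {G : Type} [Group G]
    (S : Set G) (n : ℕ) :
    {a : MonoidAlgebra K G | ∃ (h : MonoidAlgebra K G) (l : List (MonoidAlgebra K G)),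
      h ∈ MonoidAlgebra.of K G '' S ∧ (∀ x ∈ l, x ∈ MonoidAlgebra.of K G '' S) ∧
      l.length + 1 ≤ n ∧
      a = l.foldl (fun x y => LinearMap.mul K (MonoidAlgebra K G) x y) h} =
      MonoidAlgebra.of K G '' ballSet S n := by
  have foldl_of (l : List G) (g : G) :
      (l.map (MonoidAlgebra.of K G)).foldl
        (fun x y => LinearMap.mul K (MonoidAlgebra K G) x y) (MonoidAlgebra.of K G g) =
      MonoidAlgebra.of K G (l.foldl (· * ·) g) := by
    rw [List.foldl_map]
    exact (List.foldl_hom (MonoidAlgebra.of K G) fun x y => (map_mul _ x y).symm)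
  ext a
  constructor
  · rintro ⟨_, l, ⟨h, hh, rfl⟩, hl, hn, rfl⟩
    obtain ⟨m, hm, rfl⟩ : ∃ m : List G, (∀ x ∈ m, x ∈ S) ∧ m.map (MonoidAlgebra.of K G) = l := by
      choose! f hfS hf using hl
      exact ⟨l.map f, by simpa using hfS, List.map_map.trans ((List.map_congr_left hf).trans l.map_id')⟩
    exact ⟨_, ⟨h, m, hh, hm, by simpa using hn, rfl⟩, (foldl_of m h).symm⟩
  · rintro ⟨_, ⟨h, l, hh, hl, hn, rfl⟩, rfl⟩
    refine ⟨_, l.map (MonoidAlgebra.of K G), Set.mem_image_of_mem _ hh, ?_, by simpa using hn,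
      (foldl_of l h).symm⟩
    intro x hx
    obtain ⟨y, hy, rfl⟩ := List.mem_map.mp hx
    exact Set.mem_image_of_mem _ (hl y hy)

theorem linearIndependent_monoidAlgebra_of (K : Type) [Field K] (G : Type) [Group G] :
    LinearIndependent K (MonoidAlgebra.of K G) :=
  LinearIndependent.of_comp (MonoidAlgebra.coeffLinearEquiv K).toLinearMap
    (Finsupp.linearIndependent_single_one K G)

/-- No finiteness is needed: if `ballSet S n` is infinite, both sides are `0`. -/
theorem finrank_WSpan_groupAlgebra {K : Type} [Field K] {G : Type} [Group G]
    (S : Set G) (n : ℕ) :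
    Module.finrank K (WSpan (LinearMap.mul K (MonoidAlgebra K G))
      (MonoidAlgebra.of K G '' S) n) = (ballSet S n).ncard := by
  rw [WSpan, setOf_foldl_mul_image_eq_image_ballSet, Module.finrank,
    rank_span_set ((linearIndependent_monoidAlgebra_of K G).linearIndepOn _).id_image]
  exact Set.ncard_image_of_injective _ MonoidAlgebra.of_injective

/-- For a finite subset `S` of a group `G` with image `S̄` in the group algebra `K[G]`,
the exponential algebraic growth rate of `(K[G], S̄)` equals
`limsup_{n→∞} (1/n) log card B_S(n)`. In particular, when `S` is a symmetric finite
generating set, it coincides with the exponential growth rate of the group `G` w.r.t. `S`. -/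
theorem algGrowth_groupAlgebra_eq_growth_of_group {K : Type} [Field K] {G : Type} [Group G]
    (S : Finset G) :
    algGrowth (LinearMap.mul K (MonoidAlgebra K G))
        ((MonoidAlgebra.of K G) '' (↑S : Set G)) =
      Filter.limsup
        (fun n : ℕ => Real.log ((ballSet (↑S : Set G) n).ncard) / (n : ℝ))
        Filter.atTop := by
  simp only [algGrowth, finrank_WSpan_groupAlgebra]
end

section
/- Let f : [0,∞) → [0,∞) be a continuous function, let η > 0 and C > 0 be constants, and suppose there is a sequence (a_j) with a_j → ∞ such that ∫₀^{a_j} f(t) dt ≥ C · e^{η a_j} for every j. Then limsup_{t→∞} (log f(t))/t ≥ η. -/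
open Filter

/-- If `f ≤ exp (c t)` for `t ≥ T`, then `∫₀ᵃ f` is at most `∫₀ᵀ f + a exp (c a)` for `a ≥ T`. -/
lemma integral_le_add_mul_exp {f : ℝ → ℝ} (hf : ContinuousOn f (Set.Ici 0)) {c T a : ℝ}
    (hc : 0 ≤ c) (hT : 0 ≤ T) (hTa : T ≤ a) (hle : ∀ t, T ≤ t → f t ≤ Real.exp (c * t)) :
    ∫ t in (0 : ℝ)..a, f t ≤ (∫ t in (0 : ℝ)..T, f t) + a * Real.exp (c * a) := by
  have hint : ∀ x y : ℝ, 0 ≤ x → x ≤ y → IntervalIntegrable f MeasureTheory.volume x y :=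
    fun x y hx hxy => (hf.mono fun t ht => hx.trans ht.1).intervalIntegrable_of_Icc hxy
  rw [← intervalIntegral.integral_add_adjacent_intervals (hint 0 T le_rfl hT) (hint T a hT hTa)]
  have h : ∫ t in T..a, f t ≤ ∫ _ in T..a, Real.exp (c * a) := by
    refine intervalIntegral.integral_mono_on hTa (hint T a hT hTa) (by simp) fun t ht => ?_
    exact (hle t ht.1).trans (Real.exp_le_exp.2 (mul_le_mul_of_nonneg_left ht.2 hc))
  rw [intervalIntegral.integral_const, smul_eq_mul] at h
  nlinarith [Real.exp_pos (c * a)]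

/-- The function `K + x exp (c x)` is eventually smaller than `C exp (η x)` when `c < η`. -/
lemma eventually_add_mul_exp_lt {η C c : ℝ} (K : ℝ) (hη : 0 < η) (hC : 0 < C) (hc : c < η) :
    ∀ᶠ x in atTop, K + x * Real.exp (c * x) < C * Real.exp (η * x) := by
  have h1 := tendsto_rpow_mul_exp_neg_mul_atTop_nhds_zero 1 (η - c) (sub_pos.2 hc)
  have h2 := (tendsto_rpow_mul_exp_neg_mul_atTop_nhds_zero 0 η hη).const_mul K
  have h := h2.add h1
  rw [mul_zero, add_zero] at h
  filter_upwards [h.eventually_lt_const hC] with x hx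
  have hmul := mul_lt_mul_of_pos_right hx (Real.exp_pos (η * x))
  have e1 : Real.exp (-η * x) * Real.exp (η * x) = 1 := by
    rw [← Real.exp_add]; simp
  have e2 : Real.exp (-(η - c) * x) * Real.exp (η * x) = Real.exp (c * x) := by
    rw [← Real.exp_add]; ring_nf
  simp only [Real.rpow_zero, Real.rpow_one, one_mul] at hmul
  rwa [add_mul, mul_assoc, mul_assoc, e1, e2, mul_one] at hmul

/-- If `f : [0,∞) → [0,∞)` is continuous and there are constants `η, C > 0` and a sequence
`a_j → ∞` with `∫₀^{a_j} f(t) dt ≥ C·e^{η a_j}` for every `j`, then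
`limsup_{t→∞} (log f(t))/t ≥ η` (the limsup taken in the extended reals). -/
theorem limsup_log_div_ge_of_integral_ge_exp
    (f : ℝ → ℝ) (hf_cont : ContinuousOn f (Set.Ici 0))
    (hf_nonneg : ∀ t ∈ Set.Ici (0 : ℝ), 0 ≤ f t)
    (η C : ℝ) (hη : 0 < η) (hC : 0 < C)
    (a : ℕ → ℝ) (ha : Tendsto a atTop atTop)
    (hint : ∀ j, C * Real.exp (η * a j) ≤ ∫ t in (0 : ℝ)..(a j), f t) :
    (η : EReal) ≤ limsup (fun t : ℝ => ((Real.log (f t) / t : ℝ) : EReal)) atTop := by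
  by_contra! hlt
  obtain ⟨b, hb, hbη⟩ := EReal.lt_iff_exists_real_btwn.1 hlt
  have hbη : b < η := EReal.coe_lt_coe_iff.1 hbη
  obtain ⟨c, hbc, hc, hcη⟩ : ∃ c, b ≤ c ∧ 0 ≤ c ∧ c < η :=
    ⟨max b 0, le_max_left _ _, le_max_right _ _, max_lt hbη hη⟩
  have hev : ∀ᶠ t in atTop, f t ≤ Real.exp (c * t) := by
    filter_upwards [eventually_lt_of_limsup_lt hb, eventually_gt_atTop 0] with t ht ht0
    have ht : Real.log (f t) / t < b := EReal.coe_lt_coe_iff.1 ht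
    rw [div_lt_iff₀ ht0] at ht
    rcases (hf_nonneg t ht0.le).eq_or_lt with h0 | hpos
    · rw [← h0]; positivity
    · rw [← Real.log_le_iff_le_exp hpos]
      exact ht.le.trans (mul_le_mul_of_nonneg_right hbc ht0.le)
  obtain ⟨T, hT⟩ := eventually_atTop.1 (hev.and (eventually_ge_atTop 0))
  have hK := eventually_add_mul_exp_lt (∫ t in (0 : ℝ)..T, f t) hη hC hcη
  obtain ⟨j, hj, hTj⟩ := ((ha.eventually hK).and (ha.eventually_ge_atTop T)).exists
  exact absurd ((hint j).trans (integral_le_add_mul_exp hf_cont hc (hT T le_rfl).2 hTj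
    fun t ht => (hT t ht).1)) hj.not_ge
end
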